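/- Let x and y be positive integers and let p ≥ 3 be a prime. Then p·x·y·(x+y) divides x^p + y^p − (x+y)^p. -/

import Mathlib

/-- For an odd prime `p`, the cofactor of `p * x * y` in `(x + y) ^ p - x ^ p - y ^ p` vanishes at
`x = -y`, hence is divisible by `x + y`. -/
theorem Int.mul_add_dvd_pow_add_pow_sub_add_pow {p : ℕ} (hp : p.Prime) (hodd : Odd p) (x y : ℤ) :
    p * x * y * (x + y) ∣ x ^ p + y ^ p - (x + y) ^ p := by
  rcases eq_or_ne y 0 with rfl | hy
  · simp [hp.ne_zero]
  let S : ℤ → ℤ := fun t ↦ ∑ k ∈ Finset.Ioo 0 p, t ^ (k - 1) * y ^ (p - k - 1) * ↑(p.choose k / p)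
  have hS (t : ℤ) : (t + y) ^ p = t ^ p + y ^ p + p * t * y * S t := add_pow_prime_eq hp t y
  have hroot : S (-y) = 0 := by
    have h := hS (-y)
    rw [neg_add_cancel, zero_pow hp.ne_zero, hodd.neg_pow, neg_add_cancel, zero_add] at h
    simpa [hp.ne_zero, hy] using h.symm
  have hdvd : x + y ∣ S x := by
    rw [← sub_zero (S x), ← hroot, ← Finset.sum_sub_distrib]
    refine Finset.dvd_sum fun k _ ↦ ?_
    rw [← sub_mul, ← sub_mul, ← sub_neg_eq_add]
    exact ((sub_dvd_pow_sub_pow x (-y) _).mul_right _).mul_right _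
  rw [hS x, sub_add_cancel_left, dvd_neg]
  exact mul_dvd_mul_left _ hdvd

theorem pxy_dvd_pow_sum (x y p : ℕ) (hx : 0 < x) (hy : 0 < y)
    (hp : Nat.Prime p) (hp3 : 3 ≤ p) :
    ((p : ℤ) * x * y * (x + y)) ∣ ((x : ℤ) ^ p + (y : ℤ) ^ p - ((x : ℤ) + y) ^ p) :=
  Int.mul_add_dvd_pow_add_pow_sub_add_pow hp (hp.odd_of_ne_two (by omega)) x y
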